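/- For every integer m ≥ 4 there exists a finite language L over a three-letter alphabet with isc(L) = m such that every partial DFA accepting L* has at least 2^{m−2} + 2^{m−3} − 1 states, and has at least 9·2^{m−3} − 2^{(m−1)/2} − 2 defined transitions if m is odd, and at least 9·2^{m−3} − 2^{(m−2)/2} − 2 defined transitions if m is even. -/

import Mathlib

open scoped Computability
open scoped Classical

/-- A partial DFA over alphabet `α` with state set `Fin n`. -/
structure PDFA (α : Type) (n : ℕ) where
  step : Fin n → α → Option (Fin n)
  start : Fin n
  accept : Finset (Fin n)

namespace PDFA

variable {α : Type} {n : ℕ}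

/-- Run the partial DFA from a state along a word; `none` if a transition is undefined. -/
def evalFrom (M : PDFA α n) : Fin n → List α → Option (Fin n)
  | q, [] => some q
  | q, a :: w => (M.step q a).bind fun q' => M.evalFrom q' w

/-- The language accepted by a partial DFA. -/
def lang (M : PDFA α n) : Language α :=
  {w | ∃ q ∈ M.accept, M.evalFrom M.start w = some q}

/-- The number of defined transitions. -/
noncomputable def transCount [Fintype α] (M : PDFA α n) : ℕ :=
  (Finset.univ.filter fun p : Fin n × α => (M.step p.1 p.2).isSome).card

/-- The number of defined `τ`-transitions. -/
noncomputable def transCountOn (M : PDFA α n) (τ : α) : ℕ :=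
  (Finset.univ.filter fun q : Fin n => (M.step q τ).isSome).card

/-- `s_τ`: 1 if a `τ`-transition is defined at the initial state, else 0. -/
def sOn (M : PDFA α n) (τ : α) : ℕ := if (M.step M.start τ).isSome then 1 else 0

/-- `s`: total over the alphabet of `s_τ`. -/
noncomputable def sTot [Fintype α] (M : PDFA α n) : ℕ := ∑ τ : α, M.sOn τ

/-- `s̄_τ = 1 - s_τ`. -/
def sbarOn (M : PDFA α n) (τ : α) : ℕ := 1 - M.sOn τ

/-- `a_τ`: the number of defined `τ`-transitions entering a final state. -/
noncomputable def aOn (M : PDFA α n) (τ : α) : ℕ :=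
  (Finset.univ.filter fun p : Fin n => ∃ q ∈ M.accept, M.step p τ = some q).card

/-- `e_τ`: the number of final states at which a `τ`-transition is defined. -/
noncomputable def eOn (M : PDFA α n) (τ : α) : ℕ :=
  (M.accept.filter fun q => (M.step q τ).isSome).card

/-- `ē_τ`: the number of final states at which no `τ`-transition is defined. -/
noncomputable def ebarOn (M : PDFA α n) (τ : α) : ℕ :=
  (M.accept.filter fun q => M.step q τ = none).card

/-- `t̄_τ`: the number of states at which no `τ`-transition is defined. -/
noncomputable def tbarOn (M : PDFA α n) (τ : α) : ℕ :=
  (Finset.univ.filter fun q : Fin n => M.step q τ = none).card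

/-- `f(A)`: the number of final states. -/
def fTot (M : PDFA α n) : ℕ := M.accept.card

/-- `f(A, i)`: the number of final states numbered strictly less than `i`. -/
noncomputable def fBelow (M : PDFA α n) (i : ℕ) : ℕ :=
  (M.accept.filter fun q => (q : ℕ) < i).card

/-- `t̄_τ(L, i)`: 1 if no `τ`-transition is defined at state `i`, else 0. -/
noncomputable def tbarAt (M : PDFA α n) (τ : α) (i : ℕ) : ℕ :=
  if h : i < n then (if M.step ⟨i, h⟩ τ = none then 1 else 0) else 0

/-- The states (numbered by `Fin n`) are topologically ordered: the initial state is `0`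
and every defined transition goes from a smaller-numbered to a larger-numbered state. -/
def Ordered (M : PDFA α n) : Prop :=
  (M.start : ℕ) = 0 ∧ ∀ q a q', M.step q a = some q' → q < q'

end PDFA

/-- The incomplete state complexity: the minimal number of states of a partial DFA
accepting `L`. -/
noncomputable def isc {α : Type} (L : Language α) : ℕ :=
  sInf {m | ∃ M : PDFA α m, M.lang = L}

/-- The incomplete transition complexity: the minimal number of defined transitions
over all partial DFAs accepting `L`. -/
noncomputable def itc {α : Type} [Fintype α] (L : Language α) : ℕ :=
  sInf {t | ∃ m, ∃ M : PDFA α m, M.lang = L ∧ M.transCount = t}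

/-- The minimal number of defined `τ`-transitions over all partial DFAs accepting `L`. -/
noncomputable def itcOn {α : Type} (L : Language α) (τ : α) : ℕ :=
  sInf {t | ∃ m, ∃ M : PDFA α m, M.lang = L ∧ M.transCountOn τ = t}

namespace PDFA

variable {α : Type} {k : ℕ}

theorem evalFrom_append (M : PDFA α k) (q : Fin k) (u v : List α) :
    M.evalFrom q (u ++ v) = (M.evalFrom q u).bind fun p => M.evalFrom p v := by
  induction u generalizing q with
  | nil => rfl
  | cons a u ih =>
    simp only [List.cons_append, evalFrom]
    cases M.step q a with
    | none => rfl
    | some p => exact ih p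

theorem append_mem_lang (M : PDFA α k) (u v : List α) :
    u ++ v ∈ M.lang ↔
      ∃ q, M.evalFrom M.start u = some q ∧ ∃ p ∈ M.accept, M.evalFrom q v = some p := by
  change (∃ p ∈ M.accept, M.evalFrom M.start (u ++ v) = some p) ↔ _
  rw [evalFrom_append]
  cases M.evalFrom M.start u <;> simp

/-- A family of live, pairwise distinguishable words leads to distinct states. -/
theorem exists_injective_state {ι : Type*} (M : PDFA α k) (u : ι → List α)
    (live : ∀ i, ∃ z, u i ++ z ∈ M.lang)
    (dist : ∀ i j, (∀ z, u i ++ z ∈ M.lang ↔ u j ++ z ∈ M.lang) → i = j) :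
    ∃ q : ι → Fin k, Function.Injective q ∧ ∀ i, M.evalFrom M.start (u i) = some (q i) := by
  have h : ∀ i, ∃ q, M.evalFrom M.start (u i) = some q := fun i => by
    obtain ⟨z, hz⟩ := live i
    obtain ⟨q, hq, -⟩ := (M.append_mem_lang _ _).1 hz
    exact ⟨q, hq⟩
  choose q hq using h
  refine ⟨q, fun i j hij => dist i j fun z => ?_, hq⟩
  rw [append_mem_lang, append_mem_lang, hq, hq, hij]

theorem card_le_of_distinguishable {ι : Type*} (M : PDFA α k) (s : Finset ι) (u : ι → List α)
    (live : ∀ i ∈ s, ∃ z, u i ++ z ∈ M.lang)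
    (dist : ∀ i ∈ s, ∀ j ∈ s, (∀ z, u i ++ z ∈ M.lang ↔ u j ++ z ∈ M.lang) → i = j) :
    s.card ≤ k := by
  obtain ⟨q, hq, -⟩ := M.exists_injective_state (fun i : s => u i) (fun i => live i i.2)
    fun i j h => Subtype.ext (dist i i.2 j j.2 h)
  simpa using Fintype.card_le_of_injective q hq

theorem card_le_transCount [Fintype α] {ι : Type*} (M : PDFA α k) (s : Finset ι)
    (u : ι → List α) (E : Finset (ι × α)) (hE : ∀ e ∈ E, e.1 ∈ s)
    (live : ∀ i ∈ s, ∃ z, u i ++ z ∈ M.lang)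
    (dist : ∀ i ∈ s, ∀ j ∈ s, (∀ z, u i ++ z ∈ M.lang ↔ u j ++ z ∈ M.lang) → i = j)
    (liveE : ∀ e ∈ E, ∃ z, u e.1 ++ e.2 :: z ∈ M.lang) :
    E.card ≤ M.transCount := by
  obtain ⟨q, hq, hqu⟩ := M.exists_injective_state (fun i : s => u i) (fun i => live i i.2)
    fun i j h => Subtype.ext (dist i i.2 j j.2 h)
  refine Finset.card_le_card_of_injOn
    (fun e => if h : e.1 ∈ s then (q ⟨e.1, h⟩, e.2) else (M.start, e.2)) ?_ ?_
  · intro e he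
    have hs := hE e he
    obtain ⟨z, hz⟩ := liveE e he
    obtain ⟨p, hp, r, -, hr⟩ := (M.append_mem_lang _ _).1 hz
    have hp' := hqu ⟨e.1, hs⟩
    obtain rfl : q ⟨e.1, hs⟩ = p := Option.some.inj (hp'.symm.trans hp)
    simp only [evalFrom, Option.bind_eq_some_iff] at hr
    obtain ⟨t, ht, -⟩ := hr
    simp [hs, ht]
  · intro e he f hf h
    have hs := hE e he
    have ht := hE f hf
    simp only [hs, ht, dif_pos, Prod.mk.injEq] at h
    have := congrArg Subtype.val (hq h.1)
    exact Prod.ext this h.2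

end PDFA

theorem Language.IsRegular.exists_pdfa {α : Type} {L : Language α} (h : L.IsRegular) :
    ∃ (k : ℕ) (M : PDFA α k), M.lang = L := by
  obtain ⟨σ, _, D, rfl⟩ := h
  let e := Fintype.equivFin σ
  let M : PDFA α (Fintype.card σ) :=
    { step := fun q a => some (e (D.step (e.symm q) a))
      start := e D.start
      accept := Finset.univ.filter fun q => e.symm q ∈ D.accept }
  have eval : ∀ (w : List α) (s : σ), M.evalFrom (e s) w = some (e (D.evalFrom s w)) := by
    intro w
    induction w with
    | nil => intro s; rfl
    | cons a w ih => intro s; simp [PDFA.evalFrom, M, ← ih]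
  refine ⟨_, M, Language.ext fun w => ?_⟩
  change (∃ q ∈ M.accept, M.evalFrom (e D.start) w = some q) ↔ D.evalFrom D.start w ∈ D.accept
  rw [eval]
  simp [M]

theorem Language.mem_kstar_iff_last {α : Type} {l : Language α} {u : List α} :
    u ∈ l∗ ↔ u = [] ∨ ∃ v ∈ l∗, ∃ w ∈ l, v ++ w = u := by
  conv_lhs => rw [← Language.one_add_kstar_mul_self_eq_kstar]
  rw [Language.mem_add, Language.mem_one, Language.mem_mul]

theorem le_isc {α : Type} {L : Language α} {b : ℕ} (h : ∃ (k : ℕ) (M : PDFA α k), M.lang = L)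
    (hb : ∀ (k : ℕ) (M : PDFA α k), M.lang = L → b ≤ k) : b ≤ isc L :=
  le_csInf h fun k ⟨M, hM⟩ => hb k M hM

theorem le_itc {α : Type} [Fintype α] {L : Language α} {b : ℕ}
    (h : ∃ (k : ℕ) (M : PDFA α k), M.lang = L)
    (hb : ∀ (k : ℕ) (M : PDFA α k), M.lang = L → b ≤ M.transCount) : b ≤ itc L := by
  obtain ⟨k, M, hM⟩ := h
  refine le_csInf ⟨_, k, M, hM, rfl⟩ ?_
  rintro _ ⟨k, M, hM, rfl⟩
  exact hb k M hM

namespace StarWitness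

/-- Letter `x` moves position `i` to `i + 1`. -/
def Shifts (n : ℕ) (x : Fin 3) (i : ℕ) : Prop := (x = 1 → i ≠ 0) ∧ (x = 2 → Even (n + i))

/-- One step of the subset automaton for the star of the witness language: positions
`0, …, n` are tracked, and `0` is present exactly when the word read belongs to the star. -/
noncomputable def next (n : ℕ) (S : Finset ℕ) (x : Fin 3) : Finset ℕ :=
  (Finset.range (n + 1)).filter fun j =>
    (j ≠ 0 ∧ j - 1 ∈ S ∧ Shifts n x (j - 1)) ∨
      (j = 0 ∧ ((n - 1 ∈ S ∧ Shifts n x (n - 1)) ∨ n ∈ S ∨ (x = 1 ∧ 0 ∈ S)))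

noncomputable def run (n : ℕ) (S : Finset ℕ) (u : List (Fin 3)) : Finset ℕ := u.foldl (next n) S

variable {n : ℕ}

theorem run_cons (S : Finset ℕ) (x : Fin 3) (u : List (Fin 3)) :
    run n S (x :: u) = run n (next n S x) u := rfl

theorem run_append (S : Finset ℕ) (u v : List (Fin 3)) :
    run n S (u ++ v) = run n (run n S u) v := List.foldl_append

theorem run_append_singleton (S : Finset ℕ) (u : List (Fin 3)) (x : Fin 3) :
    run n S (u ++ [x]) = next n (run n S u) x := by rw [run_append]; rfl

theorem succ_mem_next {S : Finset ℕ} {x : Fin 3} {j : ℕ} :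
    j + 1 ∈ next n S x ↔ j < n ∧ j ∈ S ∧ Shifts n x j := by
  simp [next]

theorem zero_mem_next {S : Finset ℕ} {x : Fin 3} :
    0 ∈ next n S x ↔ (n - 1 ∈ S ∧ Shifts n x (n - 1)) ∨ n ∈ S ∨ (x = 1 ∧ 0 ∈ S) := by
  simp [next]

theorem next_subset (S : Finset ℕ) (x : Fin 3) : next n S x ⊆ Finset.range (n + 1) :=
  Finset.filter_subset _ _

theorem run_subset (u : List (Fin 3)) : run n {0} u ⊆ Finset.range (n + 1) := by
  induction u using List.reverseRecOn with
  | nil => simp [run]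
  | append_singleton u x _ => rw [run_append_singleton]; exact next_subset _ _

theorem shifts_zero (i : ℕ) : Shifts n 0 i := by simp [Shifts]

theorem shifts_one {i : ℕ} : Shifts n 1 i ↔ i ≠ 0 := by simp [Shifts]

theorem shifts_two {i : ℕ} : Shifts n 2 i ↔ Even (n + i) := by simp [Shifts]

theorem mem_next {S : Finset ℕ} {x : Fin 3} {j : ℕ} :
    j ∈ next n S x ↔ (1 ≤ j ∧ j ≤ n ∧ j - 1 ∈ S ∧ Shifts n x (j - 1)) ∨
      (j = 0 ∧ ((n - 1 ∈ S ∧ Shifts n x (n - 1)) ∨ n ∈ S ∨ (x = 1 ∧ 0 ∈ S))) := by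
  cases j with
  | zero => simp [zero_mem_next]
  | succ j => simp [succ_mem_next]

theorem mem_next_zero {S : Finset ℕ} {j : ℕ} :
    j ∈ next n S 0 ↔ (1 ≤ j ∧ j ≤ n ∧ j - 1 ∈ S) ∨ (j = 0 ∧ (n - 1 ∈ S ∨ n ∈ S)) := by
  simp [mem_next, shifts_zero]

theorem mem_next_one {S : Finset ℕ} {j : ℕ} :
    j ∈ next n S 1 ↔ (1 ≤ j ∧ j ≤ n ∧ j - 1 ∈ S ∧ j - 1 ≠ 0) ∨
      (j = 0 ∧ ((n - 1 ∈ S ∧ n - 1 ≠ 0) ∨ n ∈ S ∨ 0 ∈ S)) := by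
  simp only [mem_next, shifts_one, true_and]

/-! ### Distinguishing words -/

theorem mem_run_replicate (S : Finset ℕ) (t j : ℕ) (hj : j ≠ 0) (htj : t ≤ j) (hjn : j ≤ n) :
    j ∈ run n S (List.replicate t 0) ↔ j - t ∈ S := by
  induction t generalizing j with
  | zero => rfl
  | succ t ih =>
    obtain ⟨i, rfl⟩ := Nat.exists_eq_succ_of_ne_zero hj
    rw [List.replicate_succ', run_append_singleton, Nat.succ_eq_add_one, succ_mem_next]
    by_cases hi : i = 0
    · obtain rfl : t = 0 := by omega
      subst hi
      simp [run, shifts_zero]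
      omega
    · rw [ih i hi (by omega) (by omega), show i + 1 - (t + 1) = i - t by omega]
      simp [shifts_zero]
      omega

theorem zero_mem_run_replicate (S : Finset ℕ) (t : ℕ) (htn : t + 1 < n) :
    0 ∈ run n S (List.replicate (t + 1) 0) ↔ n - (t + 1) ∈ S ∨ n - t ∈ S := by
  rw [List.replicate_succ', run_append_singleton, zero_mem_next,
    mem_run_replicate S t _ (by omega) (by omega) (by omega),
    mem_run_replicate S t _ (by omega) (by omega) le_rfl]
  simp [shifts_zero, show n - 1 - t = n - (t + 1) by omega]

theorem exists_test_word_of_even (i : ℕ) (h0 : 1 ≤ i) (hi : i ≤ n) (he : Even (n + i)) :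
    ∃ w, ∀ S, 0 ∈ run n S w ↔ i ∈ S := by
  obtain ⟨j, rfl⟩ := Nat.exists_eq_succ_of_ne_zero (Nat.one_le_iff_ne_zero.1 h0)
  have ho : ¬ Even (n + j) := by
    rw [Nat.succ_eq_add_one, ← add_assoc, Nat.even_add_one] at he; exact he
  refine ⟨2 :: List.replicate (n - (j + 1)) 0, fun S => ?_⟩
  rw [run_cons]
  obtain h | h := (Nat.lt_or_eq_of_le hi)
  · obtain ⟨t, ht⟩ : ∃ t, n - (j + 1) = t + 1 := ⟨n - (j + 1) - 1, by omega⟩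
    rw [ht, zero_mem_run_replicate _ _ (by omega), show n - (t + 1) = j + 1 by omega,
      show n - t = j + 1 + 1 by omega, succ_mem_next, succ_mem_next, shifts_two, shifts_two]
    simp only [ho, and_false, false_or]
    constructor
    · exact fun h => h.2.1
    · exact fun h' => ⟨h, h', he⟩
  · subst h
    simp only [Nat.succ_eq_add_one] at *
    simp [run, zero_mem_next, shifts_two, ho]

theorem exists_test_word (i : ℕ) (hi : i ≤ n) : ∃ w, ∀ S, 0 ∈ run n S w ↔ i ∈ S := by
  by_cases h0 : i = 0
  · exact ⟨[], fun S => by rw [h0]; rfl⟩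
  by_cases he : Even (n + i)
  · exact exists_test_word_of_even i (by omega) hi he
  · have hin : i < n := lt_of_le_of_ne hi fun h => he (by rw [h]; exact Even.add_self n)
    obtain ⟨w, hw⟩ := exists_test_word_of_even (i + 1) (by omega) hin
      (by rw [← add_assoc, Nat.even_add_one]; exact he)
    refine ⟨0 :: w, fun S => ?_⟩
    rw [run_cons, hw, succ_mem_next]
    simp [hin, shifts_zero]

/-! ### Reachable configurations -/

def Reachable (n : ℕ) (S : Finset ℕ) : Prop := ∃ u, run n {0} u = S

theorem Reachable.next {S T : Finset ℕ} (h : Reachable n S) (x : Fin 3)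
    (hT : ∀ j, j ∈ T ↔ j ∈ next n S x) : Reachable n T := by
  obtain ⟨u, rfl⟩ := h
  exact ⟨u ++ [x], by rw [run_append_singleton]; ext j; rw [hT]⟩

theorem reachable_range_two (hn : 2 ≤ n) : Reachable n (Finset.range 2) := by
  have h : ∀ t, t < n → Reachable n {t} := by
    intro t ht
    induction t with
    | zero => exact ⟨[], rfl⟩
    | succ t ih =>
      refine (ih (by omega)).next 0 fun j => ?_
      simp only [mem_next_zero, Finset.mem_singleton]
      grind
  have h1 : Reachable n {0, n} := by
    refine (h (n - 1) (by omega)).next 0 fun j => ?_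
    simp only [mem_next_zero, Finset.mem_singleton, Finset.mem_insert]
    grind
  refine h1.next 0 fun j => ?_
  simp only [mem_next_zero, Finset.mem_singleton, Finset.mem_insert, Finset.mem_range]
  grind

theorem reachable_range (hn : 2 ≤ n) (k : ℕ) (hk : k < n) : Reachable n (Finset.range (k + 2)) := by
  induction k with
  | zero => exact reachable_range_two hn
  | succ k ih =>
    have hb : ∀ t, t + k + 2 ≤ n → Reachable n (insert 0 (Finset.Icc (1 + t) (k + 1 + t))) := by
      intro t ht
      induction t with
      | zero =>
        convert ih (by omega) using 1
        ext j
        simp only [Finset.mem_insert, Finset.mem_Icc, Finset.mem_range]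
        omega
      | succ t iht =>
        refine (iht (by omega)).next 1 fun j => ?_
        simp only [mem_next_one, Finset.mem_insert, Finset.mem_Icc]
        grind
    have ha : ∀ t, t ≤ k →
        Reachable n (Finset.range (t + 2) ∪ Finset.Icc (n - k + t) n) := by
      intro t ht
      induction t with
      | zero =>
        refine (hb (n - 2 - k) (by omega)).next 0 fun j => ?_
        simp only [mem_next_zero, Finset.mem_insert, Finset.mem_Icc, Finset.mem_union,
          Finset.mem_range]
        omega
      | succ t iht =>
        refine (iht (by omega)).next 0 fun j => ?_
        simp only [mem_next_zero, Finset.mem_Icc, Finset.mem_union,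
          Finset.mem_range]
        omega
    refine (ha k le_rfl).next 0 fun j => ?_
    simp only [mem_next_zero, Finset.mem_Icc, Finset.mem_union,
      Finset.mem_range]
    omega

theorem reachable_of_predecessor {S : Finset ℕ} (hS : S ⊆ Finset.range (n + 1))
    (h0 : 0 ∈ S)
    (h : Reachable n ((Finset.range (n + 1)).filter fun j => j = 0 ∨ j = n ∨ j + 1 ∈ S)) :
    Reachable n S := by
  refine h.next (if 1 ∈ S then 0 else 1) fun j => ?_
  have hS' : ∀ i ∈ S, i ≤ n := fun i hi => Nat.lt_succ_iff.1 (Finset.mem_range.1 (hS hi))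
  have hj := hS' j
  split_ifs with h1
  · simp only [mem_next_zero, Finset.mem_filter, Finset.mem_range]
    grind
  · simp only [mem_next_one, Finset.mem_filter, Finset.mem_range]
    grind

theorem reachable_of_zero_mem_of_last_mem (hn : 2 ≤ n) {S : Finset ℕ}
    (hS : S ⊆ Finset.range (n + 1)) (h0 : 0 ∈ S) (hl : n ∈ S) : Reachable n S := by
  have h : ∀ t, t < n → ∀ S ⊆ Finset.range (n + 1), 0 ∈ S →
      (∀ j, t + 1 ≤ j → j ≤ n → j ∈ S) → Reachable n S := by
    intro t
    induction t with
    | zero =>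
      intro _ S hS h0 h
      convert reachable_range hn (n - 1) (by omega)
      ext j
      have := @hS j
      simp only [Finset.mem_range] at this ⊢
      grind
    | succ t ih =>
      intro ht S hS h0 h
      refine reachable_of_predecessor hS h0 (ih (by omega) _ (Finset.filter_subset _ _) ?_ ?_)
      · simp
      · intro j hj hjn
        simp only [Finset.mem_filter, Finset.mem_range]
        grind
  exact h (n - 1) (by omega) S hS h0 fun j h1 h2 => by
    obtain rfl : j = n := by omega
    exact hl

theorem reachable_of_zero_mem (hn : 2 ≤ n) {S : Finset ℕ}
    (hS : S ⊆ Finset.range (n + 1)) (h0 : 0 ∈ S) : Reachable n S :=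
  reachable_of_predecessor hS h0 <|
    reachable_of_zero_mem_of_last_mem hn (Finset.filter_subset _ _) (by simp) (by simp)

theorem reachable_of_zero_notMem (hn : 2 ≤ n) {S : Finset ℕ} (hS : S ⊆ Finset.range n)
    (h0 : 0 ∉ S) {t : ℕ} (ht : t ∈ S) : Reachable n S := by
  induction t generalizing S with
  | zero => exact absurd ht h0
  | succ t ih =>
    have hS' : ∀ i ∈ S, i < n := fun i hi => Finset.mem_range.1 (hS hi)
    have key : Reachable n ((Finset.range n).filter fun j => j + 1 ∈ S) := by
      by_cases h1 : 1 ∈ S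
      · refine reachable_of_zero_mem hn ?_ ?_
        · exact (Finset.filter_subset _ _).trans (Finset.range_mono (Nat.le_succ n))
        · simp only [Finset.mem_filter, Finset.mem_range]
          exact ⟨by omega, h1⟩
      · refine ih (Finset.filter_subset _ _) (by simp [h1]) ?_
        have := hS' _ ht
        simp only [Finset.mem_filter, Finset.mem_range]
        exact ⟨by omega, ht⟩
    refine key.next 0 fun j => ?_
    have hj := hS' j
    simp only [mem_next_zero, Finset.mem_filter, Finset.mem_range]
    have hl := hS' n
    clear ih key
    obtain _ | j := j
    · rw [Nat.sub_add_cancel (by omega : 1 ≤ n)]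
      grind
    · rw [Nat.add_sub_cancel]
      grind

/-! ### Live configurations -/

/-- The nonempty position sets in which position `n` only occurs together with `0`. -/
def configs (n : ℕ) : Finset (Finset ℕ) :=
  ((Finset.range (n + 1)).powerset \
    ((Finset.Ico 1 n).powerset.image (insert n))).erase ∅

theorem mem_configs {S : Finset ℕ} :
    S ∈ configs n ↔ S ≠ ∅ ∧ S ⊆ Finset.range (n + 1) ∧
      ¬ ∃ T ⊆ Finset.Ico 1 n, insert n T = S := by
  simp [configs]

theorem reachable_of_mem_configs (hn : 2 ≤ n) {S : Finset ℕ} (hS : S ∈ configs n) :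
    Reachable n S := by
  obtain ⟨hne, hsub, h⟩ := mem_configs.1 hS
  by_cases h0 : 0 ∈ S
  · exact reachable_of_zero_mem hn hsub h0
  obtain ⟨t, ht⟩ := Finset.nonempty_iff_ne_empty.2 hne
  have hS' : ∀ i ∈ S, i ≤ n := fun i hi => Nat.lt_succ_iff.1 (Finset.mem_range.1 (hsub hi))
  have hl : n ∉ S := fun hl => h ⟨S.erase n, fun i hi => by
    rw [Finset.mem_erase] at hi
    have := hS' i hi.2
    have : i ≠ 0 := fun h => h0 (h ▸ hi.2)
    rw [Finset.mem_Ico]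
    omega, Finset.insert_erase hl⟩
  refine reachable_of_zero_notMem hn (fun i hi => ?_) h0 ht
  exact Finset.mem_range.2 (lt_of_le_of_ne (hS' i hi) fun h => hl (h ▸ hi))

theorem card_configs (n : ℕ) : 2 ^ (n + 1 + 1) - 2 ^ n - 1 ≤ (configs (n + 1)).card := by
  have h1 : ((Finset.Ico 1 (n + 1)).powerset.image (insert (n + 1))).card ≤ 2 ^ n :=
    Finset.card_image_le.trans (by simp)
  have h2 := Finset.le_card_sdiff ((Finset.Ico 1 (n + 1)).powerset.image (insert (n + 1)))
    (Finset.range (n + 1 + 1)).powerset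
  have h3 := Finset.pred_card_le_card_erase (a := (∅ : Finset ℕ))
    (s := (Finset.range (n + 1 + 1)).powerset \
      ((Finset.Ico 1 (n + 1)).powerset.image (insert (n + 1))))
  rw [Finset.card_powerset, Finset.card_range] at h2
  rw [configs]
  omega

/-- Positions below `n` at which the letter `2` is undefined. -/
def blocked (n : ℕ) : Finset ℕ := (Finset.range n).filter fun i => ¬ Even (n + i)

theorem card_blocked_le (n : ℕ) : (blocked n).card ≤ (n + 1) / 2 := by
  have h : blocked n ⊆ (Finset.range ((n + 1) / 2)).image fun t => n - 1 - 2 * t := by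
    intro i hi
    simp only [blocked, Finset.mem_filter, Finset.mem_range, Nat.not_even_iff] at hi
    simp only [Finset.mem_image, Finset.mem_range]
    exact ⟨(n - 1 - i) / 2, by omega, by omega⟩
  simpa using (Finset.card_le_card h).trans Finset.card_image_le

/-- The pairs of a configuration and a letter after which a configuration remains. -/
noncomputable def livePairs (n : ℕ) : Finset (Finset ℕ × Fin 3) :=
  (configs n ×ˢ Finset.univ) \ (((blocked n).powerset.erase ∅) ×ˢ {2})

theorem card_livePairs (n : ℕ) :
    3 * (configs n).card - (2 ^ ((n + 1) / 2) - 1) ≤ (livePairs n).card := by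
  have h1 := Finset.le_card_sdiff (((blocked n).powerset.erase ∅) ×ˢ ({2} : Finset (Fin 3)))
    (configs n ×ˢ Finset.univ)
  have h2 : (blocked n).powerset.card ≤ 2 ^ ((n + 1) / 2) := by
    rw [Finset.card_powerset]
    exact Nat.pow_le_pow_right two_pos (card_blocked_le n)
  rw [Finset.card_product, Finset.card_product, Finset.card_singleton,
    Finset.card_erase_of_mem (Finset.empty_mem_powerset _), Finset.card_univ, Fintype.card_fin] at h1
  rw [livePairs]
  omega

theorem exists_live_word {S : Finset ℕ} (hne : S.Nonempty) (hS : S ⊆ Finset.range (n + 1)) :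
    ∃ w, 0 ∈ run n S w := by
  obtain ⟨i, hi⟩ := hne
  obtain ⟨w, hw⟩ := exists_test_word i (Nat.lt_succ_iff.1 (Finset.mem_range.1 (hS hi)))
  exact ⟨w, (hw S).2 hi⟩

theorem exists_live_word_of_mem_livePairs {e : Finset ℕ × Fin 3}
    (he : e ∈ livePairs n) : ∃ w, 0 ∈ run n e.1 (e.2 :: w) := by
  obtain ⟨S, x⟩ := e
  simp only [livePairs, Finset.mem_sdiff, Finset.mem_product, Finset.mem_univ, and_true,
    Finset.mem_erase, Finset.mem_powerset, Finset.mem_singleton, mem_configs] at he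
  obtain ⟨⟨hne, hsub, -⟩, h⟩ := he
  have hS' : ∀ i ∈ S, i ≤ n := fun i hi => Nat.lt_succ_iff.1 (Finset.mem_range.1 (hsub hi))
  refine exists_live_word (S := next n S x) ?_ (next_subset _ _)
  by_contra hemp
  rw [Finset.not_nonempty_iff_eq_empty] at hemp
  have hl : n ∉ S := fun hl => by
    have : 0 ∈ next n S x := zero_mem_next.2 (Or.inr (Or.inl hl))
    simp [hemp] at this
  have hlt : ∀ i ∈ S, i < n := fun i hi => lt_of_le_of_ne (hS' i hi) fun h => hl (h ▸ hi)
  have hns : ∀ i ∈ S, ¬ Shifts n x i := fun i hi hs => by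
    have : i + 1 ∈ next n S x := succ_mem_next.2 ⟨hlt i hi, hi, hs⟩
    simp [hemp] at this
  obtain ⟨i, hi⟩ := Finset.nonempty_iff_ne_empty.2 hne
  obtain rfl | rfl | rfl : x = 0 ∨ x = 1 ∨ x = 2 := by fin_cases x <;> simp
  · exact hns i hi (shifts_zero i)
  · have h0 : i = 0 := by simpa [shifts_one] using hns i hi
    have : 0 ∈ next n S 1 := zero_mem_next.2 (Or.inr (Or.inr ⟨rfl, h0 ▸ hi⟩))
    simp [hemp] at this
  · refine h ⟨⟨hne, fun j hj => ?_⟩, rfl⟩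
    rw [blocked, Finset.mem_filter, Finset.mem_range]
    exact ⟨hlt j hj, fun he => hns j hj (shifts_two.2 he)⟩

end StarWitness

namespace PDFA

variable {α : Type} {k : ℕ}

/-- Some decomposition of `u` as a word of the star followed by a word leading to `p`. -/
def Tracks (M : PDFA α k) (u : List α) (p : Fin k) : Prop :=
  ∃ v ∈ M.lang∗, ∃ w, v ++ w = u ∧ M.evalFrom M.start w = some p

theorem evalFrom_append_singleton_eq_some {M : PDFA α k} {s p : Fin k} {w : List α} {x : α} :
    M.evalFrom s (w ++ [x]) = some p ↔ ∃ q, M.evalFrom s w = some q ∧ M.step q x = some p := by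
  rw [evalFrom_append, Option.bind_eq_some_iff]
  simp [evalFrom]

theorem tracks_append_singleton {M : PDFA α k} {u : List α} {x : α} {p : Fin k}
    (hp : p ≠ M.start) :
    M.Tracks (u ++ [x]) p ↔ ∃ q, M.Tracks u q ∧ M.step q x = some p := by
  constructor
  · rintro ⟨v, hv, w, hvw, hw⟩
    obtain rfl | ⟨w, y, rfl⟩ := List.eq_nil_or_concat w
    · exact absurd (Option.some.inj hw).symm hp
    rw [List.concat_eq_append] at hvw hw
    rw [← List.append_assoc] at hvw
    obtain ⟨rfl, hy⟩ := List.append_inj' hvw rfl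
    obtain rfl := List.singleton_inj.1 hy
    obtain ⟨q, hq, hqp⟩ := evalFrom_append_singleton_eq_some.1 hw
    exact ⟨q, ⟨v, hv, w, rfl, hq⟩, hqp⟩
  · rintro ⟨q, ⟨v, hv, w, rfl, hq⟩, hqp⟩
    exact ⟨v, hv, w ++ [x], (List.append_assoc _ _ _).symm,
      evalFrom_append_singleton_eq_some.2 ⟨q, hq, hqp⟩⟩

theorem append_singleton_mem_kstar {M : PDFA α k} {u : List α} {x : α} :
    u ++ [x] ∈ M.lang∗ ↔ ∃ p ∈ M.accept, M.Tracks (u ++ [x]) p := by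
  rw [Language.mem_kstar_iff_last]
  constructor
  · rintro (h | ⟨v, hv, w, ⟨p, hp, hw⟩, h⟩)
    · simp at h
    · exact ⟨p, hp, v, hv, w, h, hw⟩
  · rintro ⟨p, hp, v, hv, w, h, hw⟩
    exact Or.inr ⟨v, hv, w, ⟨p, hp, hw⟩, h⟩

theorem tracks_start {M : PDFA α k} (h : ∀ q x, M.step q x ≠ some M.start) {u : List α} :
    M.Tracks u M.start ↔ u ∈ M.lang∗ := by
  constructor
  · rintro ⟨v, hv, w, rfl, hw⟩
    obtain rfl | ⟨w, y, rfl⟩ := List.eq_nil_or_concat w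
    · rwa [List.append_nil]
    rw [List.concat_eq_append] at hw
    obtain ⟨q, -, hq⟩ := evalFrom_append_singleton_eq_some.1 hw
    exact absurd hq (h q y)
  · exact fun hu => ⟨u, hu, [], List.append_nil u, rfl⟩

end PDFA

namespace StarWitness

variable {n : ℕ}

/-- The target of letter `x` at state `i`, when defined. -/
def target (n : ℕ) (x : Fin 3) (i : ℕ) : ℕ := if x = 1 ∧ i = 0 then n + 1 else i + 1

/-- A chain of `n + 2` states whose last two states are final; letter `1` jumps from the initial
state to the last one and letter `2` is defined at every other state. -/
noncomputable def witness (n : ℕ) : PDFA (Fin 3) (n + 2) where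
  step q x := if h : target n x q < n + 2 ∧ (x = 2 → Even (n + q)) then
    some ⟨target n x q, h.1⟩ else none
  start := 0
  accept := Finset.univ.filter fun q => n ≤ (q : ℕ)

theorem witness_step {q p : Fin (n + 2)} {x : Fin 3} :
    (witness n).step q x = some p ↔ (p : ℕ) = target n x q ∧ (x = 2 → Even (n + q)) := by
  have hp := p.2
  simp only [witness]
  split_ifs with h
  · rw [Option.some_inj, Fin.ext_iff]
    exact ⟨fun hh => ⟨hh.symm, h.2⟩, fun hh => hh.1.symm⟩
  · refine iff_of_false id ?_
    exact fun hh => h ⟨hh.1 ▸ hp, hh.2⟩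

theorem lt_of_witness_step {q p : Fin (n + 2)} {x : Fin 3}
    (h : (witness n).step q x = some p) : q < p := by
  have h1 := (witness_step.1 h).1
  have := p.2
  rw [target] at h1
  rw [Fin.lt_def]
  split_ifs at h1 <;> omega

theorem length_le_of_witness_evalFrom {q p : Fin (n + 2)} {w : List (Fin 3)}
    (h : (witness n).evalFrom q w = some p) : (q : ℕ) + w.length ≤ p := by
  induction w generalizing q with
  | nil => simp [Option.some.inj h]
  | cons x w ih =>
    obtain ⟨r, hr, hw⟩ := Option.bind_eq_some_iff.1 h
    have h1 := ih hw
    have h2 := Fin.lt_def.1 (lt_of_witness_step hr)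
    rw [List.length_cons]
    omega

theorem length_le_of_mem_witness_lang {w : List (Fin 3)} (h : w ∈ (witness n).lang) :
    w.length ≤ n + 1 := by
  obtain ⟨p, -, hw⟩ := h
  have := length_le_of_witness_evalFrom hw
  omega

theorem replicate_mem_witness_lang : List.replicate (n + 1) 0 ∈ (witness n).lang := by
  have h : ∀ i (hi : i < n + 2),
      (witness n).evalFrom (witness n).start (List.replicate i 0) = some ⟨i, hi⟩ := by
    intro i
    induction i with
    | zero => exact fun _ => rfl
    | succ i ih =>
      intro hi
      rw [List.replicate_succ', PDFA.evalFrom_append_singleton_eq_some]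
      exact ⟨_, ih (by omega), witness_step.2 ⟨by simp [target], by simp⟩⟩
  exact ⟨_, by simp [witness], h (n + 1) (by omega)⟩

theorem isc_witness_lang (n : ℕ) : isc (witness n).lang = n + 2 := by
  refine le_antisymm (Nat.sInf_le ⟨_, rfl⟩) (le_isc ⟨_, _, rfl⟩ fun k M hM => ?_)
  have key : ∀ i, i ≤ n + 1 → List.replicate i 0 ++ List.replicate (n + 1 - i) 0 ∈ M.lang := by
    intro i hi
    rw [hM, ← List.replicate_add, Nat.add_sub_cancel' hi]
    exact replicate_mem_witness_lang
  have le : ∀ i j, i ≤ n + 1 →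
      (∀ z, List.replicate i 0 ++ z ∈ M.lang ↔ List.replicate j 0 ++ z ∈ M.lang) → j ≤ i := by
    intro i j hi h
    have := (h _).1 (key i hi)
    rw [hM] at this
    have := length_le_of_mem_witness_lang this
    simp only [List.length_append, List.length_replicate] at this
    omega
  have hle : ∀ i ∈ Finset.range (n + 2), i ≤ n + 1 := fun i hi =>
    Nat.lt_succ_iff.1 (Finset.mem_range.1 hi)
  have := M.card_le_of_distinguishable (Finset.range (n + 2)) (fun i => List.replicate i 0)
    (fun i hi => ⟨_, key i (hle i hi)⟩)
    (fun i hi j hj h => le_antisymm (le j i (hle j hj) fun z => (h z).symm) (le i j (hle i hi) h))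
  simpa using this

theorem mem_run_iff_tracks (hn : 2 ≤ n) (u : List (Fin 3)) (p : Fin (n + 2)) (hp : (p : ℕ) ≤ n) :
    (p : ℕ) ∈ run n {0} u ↔ (witness n).Tracks u p := by
  have hstart : ∀ q x, (witness n).step q x ≠ some (witness n).start := fun q x h => by
    simpa [witness] using lt_of_witness_step h
  induction u using List.reverseRecOn generalizing p with
  | nil =>
    constructor
    · intro h
      have h0 : (p : ℕ) = 0 := by simpa [run] using h
      obtain rfl : p = (witness n).start := Fin.ext h0
      exact (PDFA.tracks_start hstart).2 (Language.nil_mem_kstar _)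
    · rintro ⟨v, -, w, hvw, hw⟩
      obtain ⟨-, rfl⟩ := List.append_eq_nil_iff.1 hvw
      rw [← Option.some.inj hw]
      simp [run, witness]
  | append_singleton u x ih =>
    rw [run_append_singleton]
    by_cases h0 : p = (witness n).start
    · subst h0
      have hz : (((witness n).start : Fin (n + 2)) : ℕ) = 0 := rfl
      rw [PDFA.tracks_start hstart, PDFA.append_singleton_mem_kstar, hz, zero_mem_next]
      have hne : ∀ r : Fin (n + 2), n ≤ (r : ℕ) → r ≠ (witness n).start := by
        rintro r hr rfl
        omega
      constructor
      · rintro (⟨h1, h2⟩ | h1 | ⟨rfl, h1⟩)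
        · refine ⟨⟨n, by omega⟩, by simp [witness], ?_⟩
          rw [PDFA.tracks_append_singleton (hne _ le_rfl)]
          refine ⟨⟨n - 1, by omega⟩, (ih _ (by simp)).1 h1, witness_step.2 ⟨?_, h2.2⟩⟩
          simp only [target]
          rw [if_neg (by omega)]
          omega
        · refine ⟨⟨n + 1, by omega⟩, by simp [witness], ?_⟩
          rw [PDFA.tracks_append_singleton (hne _ (Nat.le_succ n))]
          refine ⟨⟨n, by omega⟩, (ih _ le_rfl).1 h1, witness_step.2 ⟨?_, by simp⟩⟩
          simp only [target]
          rw [if_neg (by omega)]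
        · refine ⟨⟨n + 1, by omega⟩, by simp [witness], ?_⟩
          rw [PDFA.tracks_append_singleton (hne _ (Nat.le_succ n))]
          exact ⟨0, (ih _ (Nat.zero_le n)).1 h1, witness_step.2 ⟨by simp [target], by simp⟩⟩
      · rintro ⟨r, hr, h⟩
        have hr' : n ≤ (r : ℕ) := by simpa [witness] using hr
        have hr2 := r.2
        obtain ⟨q, hq, hqr⟩ := (PDFA.tracks_append_singleton (hne r hr')).1 h
        obtain ⟨h1, h2⟩ := witness_step.1 hqr
        rw [target] at h1
        split_ifs at h1 with h3
        · refine Or.inr (Or.inr ⟨h3.1, ?_⟩)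
          have hqR := (ih q (by omega)).2 hq
          rwa [h3.2] at hqR
        · have hqR := (ih q (by omega)).2 hq
          obtain h4 | h4 : (q : ℕ) = n - 1 ∨ (q : ℕ) = n := by omega
          · rw [h4] at hqR h2
            exact Or.inl ⟨hqR, fun _ => by omega, h2⟩
          · rw [h4] at hqR
            exact Or.inr (Or.inl hqR)
    · rw [PDFA.tracks_append_singleton h0]
      obtain ⟨j, hj⟩ : ∃ j, (p : ℕ) = j + 1 :=
        Nat.exists_eq_succ_of_ne_zero fun h => h0 (Fin.ext h)
      rw [hj, succ_mem_next]
      constructor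
      · rintro ⟨h1, h2, h3⟩
        refine ⟨⟨j, by omega⟩, (ih _ h1.le).1 h2, witness_step.2 ⟨?_, h3.2⟩⟩
        rw [target, if_neg fun h => h3.1 h.1 h.2, hj]
      · rintro ⟨q, hq, hqp⟩
        obtain ⟨h1, h2⟩ := witness_step.1 hqp
        rw [target] at h1
        split_ifs at h1 with h3
        · omega
        · obtain rfl : (q : ℕ) = j := by omega
          exact ⟨by omega, (ih q (by omega)).2 hq, fun hx h => h3 ⟨hx, h⟩, h2⟩

theorem mem_kstar_iff (hn : 2 ≤ n) (u : List (Fin 3)) :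
    u ∈ (witness n).lang∗ ↔ 0 ∈ run n {0} u := by
  rw [← PDFA.tracks_start, ← mem_run_iff_tracks hn]
  · rfl
  · exact Nat.zero_le n
  · intro q x h
    simpa [witness] using lt_of_witness_step h

theorem isRegular_kstar (hn : 2 ≤ n) : ((witness n).lang∗).IsRegular := by
  refine .of_finite_range_leftQuotient (((Finset.finite_toSet
    (Finset.range (n + 1)).powerset).image fun S => ({z | 0 ∈ run n S z} : Language _)).subset ?_)
  rintro _ ⟨u, rfl⟩
  refine ⟨run n {0} u, Finset.mem_coe.2 (Finset.mem_powerset.2 (run_subset u)),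
    Language.ext fun z => ?_⟩
  rw [Language.mem_leftQuotient, mem_kstar_iff hn, run_append]
  rfl

theorem le_states_and_le_transCount (hn : 2 ≤ n) {k : ℕ} {M : PDFA (Fin 3) k}
    (hM : M.lang = (witness n).lang∗) :
    (configs n).card ≤ k ∧ (livePairs n).card ≤ M.transCount := by
  have hreach : ∀ S, ∃ u, S ∈ configs n → run n {0} u = S := fun S => by
    by_cases hS : S ∈ configs n
    · obtain ⟨u, hu⟩ := reachable_of_mem_configs hn hS
      exact ⟨u, fun _ => hu⟩
    · exact ⟨[], fun h => absurd h hS⟩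
  choose u hu using hreach
  have hmem : ∀ S ∈ configs n, ∀ z, u S ++ z ∈ M.lang ↔ 0 ∈ run n S z := fun S hS z => by
    rw [hM, mem_kstar_iff hn, run_append, hu S hS]
  have live : ∀ S ∈ configs n, ∃ z, u S ++ z ∈ M.lang := fun S hS => by
    obtain ⟨hne, hsub, -⟩ := mem_configs.1 hS
    obtain ⟨w, hw⟩ := exists_live_word (Finset.nonempty_iff_ne_empty.2 hne) hsub
    exact ⟨w, (hmem S hS w).2 hw⟩
  have dist : ∀ S ∈ configs n, ∀ T ∈ configs n,
      (∀ z, u S ++ z ∈ M.lang ↔ u T ++ z ∈ M.lang) → S = T := by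
    intro S hS T hT h
    have hS' := (mem_configs.1 hS).2.1
    have hT' := (mem_configs.1 hT).2.1
    ext i
    by_cases hi : i ≤ n
    · obtain ⟨w, hw⟩ := exists_test_word i hi
      rw [← hw S, ← hw T, ← hmem S hS, ← hmem T hT]
      exact h w
    · have : i ∉ Finset.range (n + 1) := by simpa using hi
      exact iff_of_false (fun h => this (hS' h)) fun h => this (hT' h)
  have hconf : ∀ e ∈ livePairs n, e.1 ∈ configs n := fun e he =>
    (Finset.mem_product.1 (Finset.mem_sdiff.1 he).1).1
  refine ⟨M.card_le_of_distinguishable _ u live dist,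
    M.card_le_transCount _ u _ hconf live dist fun e he => ?_⟩
  obtain ⟨w, hw⟩ := exists_live_word_of_mem_livePairs he
  exact ⟨w, (hmem _ (hconf e he) _).2 hw⟩

end StarWitness

/-- Tightness for Kleene star: for every `m ≥ 4` there is a finite
language `L` over a three-letter alphabet with `isc L = m` such that every partial DFA
accepting `L*` needs at least `2^{m−2} + 2^{m−3} − 1` states, and at least
`9·2^{m−3} − 2^{(m−1)/2} − 2` transitions if `m` is odd, and at least
`9·2^{m−3} − 2^{(m−2)/2} − 2` transitions if `m` is even. -/
theorem star_tight (m : ℕ) (hm : 4 ≤ m) :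
    ∃ L : Language (Fin 3),
      Set.Finite {w | w ∈ L} ∧ isc L = m ∧
      (∀ (k : ℕ) (M : PDFA (Fin 3) k), M.lang = L∗ →
        2 ^ (m - 2) + 2 ^ (m - 3) - 1 ≤ k ∧
        (Odd m → 9 * 2 ^ (m - 3) - 2 ^ ((m - 1) / 2) - 2 ≤ M.transCount) ∧
        (Even m → 9 * 2 ^ (m - 3) - 2 ^ ((m - 2) / 2) - 2 ≤ M.transCount)) ∧
      2 ^ (m - 2) + 2 ^ (m - 3) - 1 ≤ isc (L∗) ∧
      (Odd m → 9 * 2 ^ (m - 3) - 2 ^ ((m - 1) / 2) - 2 ≤ itc (L∗)) ∧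
      (Even m → 9 * 2 ^ (m - 3) - 2 ^ ((m - 2) / 2) - 2 ≤ itc (L∗)) := by
  obtain ⟨k, rfl⟩ : ∃ k, m = k + 3 := ⟨m - 3, by omega⟩
  have hn : 2 ≤ k + 1 := by omega
  have hreg := (StarWitness.isRegular_kstar hn).exists_pdfa
  have key : ∀ (l : ℕ) (M : PDFA (Fin 3) l), M.lang = (StarWitness.witness (k + 1)).lang∗ →
      2 ^ (k + 3 - 2) + 2 ^ (k + 3 - 3) - 1 ≤ l ∧
      (Odd (k + 3) → 9 * 2 ^ (k + 3 - 3) - 2 ^ ((k + 3 - 1) / 2) - 2 ≤ M.transCount) ∧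
      (Even (k + 3) → 9 * 2 ^ (k + 3 - 3) - 2 ^ ((k + 3 - 2) / 2) - 2 ≤ M.transCount) := by
    intro l M hM
    obtain ⟨h1, h2⟩ := StarWitness.le_states_and_le_transCount hn hM
    have h3 := StarWitness.card_configs k
    have h4 := StarWitness.card_livePairs (k + 1)
    have h5 : 1 ≤ 2 ^ k := Nat.one_le_two_pow
    have h6 : 1 ≤ 2 ^ ((k + 1 + 1) / 2) := Nat.one_le_two_pow
    rw [pow_succ, pow_succ] at h3
    rw [show k + 3 - 2 = k + 1 by omega, show k + 3 - 3 = k by omega,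
      show k + 3 - 1 = k + 1 + 1 by omega, pow_succ]
    refine ⟨by omega, fun _ => by omega, fun he => ?_⟩
    have : (k + 1 + 1) / 2 = (k + 1) / 2 := by
      obtain ⟨r, hr⟩ := he
      omega
    rw [this] at h4 h6
    omega
  refine ⟨(StarWitness.witness (k + 1)).lang, ?_, StarWitness.isc_witness_lang (k + 1), key,
    le_isc hreg fun l M hM => (key l M hM).1,
    fun ho => le_itc hreg fun l M hM => (key l M hM).2.1 ho,
    fun he => le_itc hreg fun l M hM => (key l M hM).2.2 he⟩
  exact (List.finite_length_le (Fin 3) (k + 2)).subset fun w hw =>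
    StarWitness.length_le_of_mem_witness_lang hw
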